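/- arXiv:1702.05055 — 4 statements merged into one kernel-verified Lean document; each statement's English description precedes it below -/
import Mathlib

section
/- Let n ≥ 1 and B = ℤ^n. Let V^{⊗n} be the ℚ-vector space with basis {v_b : b ∈ B}, with linear operators F_i (i ∈ ℕ) defined by F_i(v_b) = Σ_t v_{b+d_t}, summing over those 1 ≤ t ≤ n with b_t = i or b_t = −i. Then for every b ∈ B there exist a ∈ B and a finite sequence i_1, …, i_l ∈ ℕ such that: (i) a_1 > a_2 > ⋯ > a_n and a_r + a_s ≠ 1 for all 1 ≤ r < s ≤ n; and (ii) (F_{i_l} ∘ ⋯ ∘ F_{i_1})(v_a) = v_b + w, where w is a ℚ-linear combination of vectors v_c with c ≻ b in the sp_{2∞}-Bruhat order. -/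
/-!
STATEMENT 7: for every b ∈ ℤ^n there are a strictly decreasing, "typical" tuple a
and a monomial in the operators F_i such that applying it to v_a gives v_b plus a
linear combination of v_c's with c ≻ b in the sp_{2∞}-Bruhat order.
-/

open Finsupp

abbrev PC : Type := ℕ →₀ ℤ

noncomputable def epsC (i : ℕ) : PC := Finsupp.single i 1

noncomputable def alphaC (i : ℕ) : PC := if i = 0 then -(2 • epsC 0) else epsC (i - 1) - epsC i

def DomC (lam mu : PC) : Prop :=
  ∃ c : ℕ →₀ ℕ, lam - mu = c.sum fun i k => (k : ℤ) • alphaC i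

noncomputable def psumC {n : ℕ} (β : Fin n → PC) (s : ℕ) : PC :=
  ∑ r ∈ Finset.univ.filter (fun r : Fin n => (r : ℕ) < s), β r

def InvDomC {n : ℕ} (β γ : Fin n → PC) : Prop :=
  psumC β n = psumC γ n ∧ ∀ s : ℕ, 1 ≤ s → s ≤ n → DomC (psumC β s) (psumC γ s)

noncomputable def wtC {n : ℕ} (b : Fin n → ℤ) : Fin n → PC :=
  fun r => if 0 < b r then epsC (b r - 1).toNat else -epsC (-(b r)).toNat

/-- The `sp_{2∞}`-Bruhat order. -/
def BruhatC {n : ℕ} (a b : Fin n → ℤ) : Prop := InvDomC (wtC a) (wtC b)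

/-- `d_t`, the t-th standard basis tuple of `ℤ^n`. -/
def dvec (n : ℕ) (t : Fin n) : Fin n → ℤ := fun r => if r = t then 1 else 0

/-- The space `V^{⊗n}` with monomial basis `{v_b : b ∈ ℤ^n}`. -/
abbrev VT (n : ℕ) : Type := (Fin n → ℤ) →₀ ℚ

/-- `F_i` on `V^{⊗n}`: `F_i v_b = Σ_t v_{b+d_t}`, summed over `t` with `b t = ±i`. -/
noncomputable def FF (n : ℕ) (i : ℕ) : VT n →ₗ[ℚ] VT n :=
  Finsupp.lsum ℚ fun b : Fin n → ℤ =>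
    LinearMap.toSpanSingleton ℚ (VT n)
      (∑ t ∈ Finset.univ.filter (fun t : Fin n => b t = (i : ℤ) ∨ b t = -(i : ℤ)),
        Finsupp.single (b + dvec n t) 1)

lemma FF_apply (n i : ℕ) (v : VT n) :
    FF n i v = v.sum fun c q => q •
      ∑ t ∈ Finset.univ.filter (fun t : Fin n => c t = (i : ℤ) ∨ c t = -(i : ℤ)),
        (Finsupp.single (c + dvec n t) 1 : VT n) := by
  rw [FF, Finsupp.lsum_apply]
  rfl

lemma FF_apply_apply (n i : ℕ) (v : VT n) (y : Fin n → ℤ) :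
    FF n i v y = ∑ c ∈ v.support, v c *
      ∑ t ∈ Finset.univ.filter (fun t : Fin n => c t = (i : ℤ) ∨ c t = -(i : ℤ)),
        if c + dvec n t = y then 1 else 0 := by
  simp only [FF_apply, Finsupp.sum, Finsupp.finsetSum_apply, Finsupp.smul_apply, smul_eq_mul,
    Finsupp.single_apply]

lemma exists_of_mem_support_FF {n i : ℕ} {v : VT n} {y : Fin n → ℤ}
    (hy : y ∈ (FF n i v).support) :
    ∃ c ∈ v.support, ∃ t : Fin n, (c t = (i : ℤ) ∨ c t = -(i : ℤ)) ∧ c + dvec n t = y := by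
  rw [Finsupp.mem_support_iff, FF_apply_apply] at hy
  obtain ⟨c, hc, hne⟩ := Finset.exists_ne_zero_of_sum_ne_zero hy
  obtain ⟨t, ht, hne'⟩ := Finset.exists_ne_zero_of_sum_ne_zero (right_ne_zero_of_mul hne)
  refine ⟨c, hc, t, (Finset.mem_filter.1 ht).2, ?_⟩
  by_contra h
  simp [h] at hne'

lemma wtC_add_dvec {n i : ℕ} {c : Fin n → ℤ} {t : Fin n}
    (h : c t = (i : ℤ) ∨ c t = -(i : ℤ)) (r : Fin n) :
    wtC (c + dvec n t) r = wtC c r - if r = t then alphaC i else 0 := by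
  by_cases hr : r = t
  · subst hr
    simp only [wtC, Pi.add_apply, dvec, if_true, alphaC]
    rcases Nat.eq_zero_or_pos i with rfl | hi
    · have h0 : c r = 0 := by omega
      simp [h0, two_smul]
    · rw [if_neg hi.ne']
      rcases h with h | h
      · rw [h, if_pos (by omega), if_pos (by omega)]
        rw [show ((i : ℤ) + 1 - 1).toNat = i by omega, show ((i : ℤ) - 1).toNat = i - 1 by omega]
        abel
      · rw [h, if_neg (by omega), if_neg (by omega)]
        rw [show (-(-(i : ℤ) + 1)).toNat = i - 1 by omega, show (-(-(i : ℤ))).toNat = i by omega]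
        abel
  · simp [wtC, dvec, hr]

lemma psumC_wtC_add_dvec {n i : ℕ} {c : Fin n → ℤ} {t : Fin n}
    (h : c t = (i : ℤ) ∨ c t = -(i : ℤ)) (s : ℕ) :
    psumC (wtC (c + dvec n t)) s
      = psumC (wtC c) s - if (t : ℕ) < s then alphaC i else 0 := by
  simp only [psumC, wtC_add_dvec h, Finset.sum_sub_distrib, Finset.sum_ite_eq', Finset.mem_filter,
    Finset.mem_univ, true_and]

/-- The sum of the first `s` entries of `c`. -/
def entrySum {n : ℕ} (c : Fin n → ℤ) (s : ℕ) : ℤ :=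
  ∑ r ∈ Finset.univ.filter (fun r : Fin n => (r : ℕ) < s), c r

lemma entrySum_add_dvec {n : ℕ} (c : Fin n → ℤ) (t : Fin n) (s : ℕ) :
    entrySum (c + dvec n t) s = entrySum c s + if (t : ℕ) < s then 1 else 0 := by
  simp only [entrySum, Pi.add_apply, dvec, Finset.sum_add_distrib, Finset.sum_ite_eq',
    Finset.mem_filter, Finset.mem_univ, true_and]

lemma DomC.refl (lam : PC) : DomC lam lam := ⟨0, by simp⟩

lemma DomC.sub_right {lam mu : PC} (h : DomC lam mu) (i : ℕ) : DomC lam (mu - alphaC i) := by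
  obtain ⟨c, hc⟩ := h
  refine ⟨c + Finsupp.single i 1, ?_⟩
  rw [Finsupp.sum_add_index' (by simp) (by intros; push_cast; rw [add_smul]), ← hc,
    Finsupp.sum_single_index (by simp)]
  simp only [Nat.cast_one, one_smul]
  abel

lemma DomC.sub_sub {lam mu : PC} (h : DomC lam mu) (nu : PC) : DomC (lam - nu) (mu - nu) := by
  obtain ⟨c, hc⟩ := h
  exact ⟨c, by rw [← hc]; abel⟩

/-- `c` is obtained from `x` by shifting raising steps to the left among the first `m` positions. -/
structure LeftShift {n : ℕ} (m : ℕ) (x c : Fin n → ℤ) : Prop where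
  eq_of_le : ∀ s : Fin n, m ≤ s → c s = x s
  total : psumC (wtC x) n = psumC (wtC c) n
  dom : ∀ s, DomC (psumC (wtC x) s) (psumC (wtC c) s)
  entry : ∀ s, entrySum x s ≤ entrySum c s

lemma LeftShift.refl {n : ℕ} (m : ℕ) (x : Fin n → ℤ) : LeftShift m x x :=
  ⟨fun _ _ => rfl, rfl, fun _ => DomC.refl _, fun _ => le_rfl⟩

lemma LeftShift.mono {n m m' : ℕ} {x c : Fin n → ℤ} (h : LeftShift m x c) (hm : m ≤ m') :
    LeftShift m' x c :=
  ⟨fun s hs => h.eq_of_le s (hm.trans hs), h.total, h.dom, h.entry⟩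

lemma LeftShift.add_dvec {n m i : ℕ} {x c : Fin n → ℤ} (h : LeftShift m x c) {t u : Fin n}
    (hut : u ≤ t) (htm : (t : ℕ) < m) (hx : x t = (i : ℤ) ∨ x t = -(i : ℤ))
    (hc : c u = (i : ℤ) ∨ c u = -(i : ℤ)) :
    LeftShift m (x + dvec n t) (c + dvec n u) where
  eq_of_le s hs := by
    have h1 : s ≠ t := by rintro rfl; omega
    have h2 : s ≠ u := by rintro rfl; have : (s : ℕ) ≤ t := hut; omega
    simp [dvec, h1, h2, h.eq_of_le s hs]
  total := by
    rw [psumC_wtC_add_dvec hx, psumC_wtC_add_dvec hc, if_pos t.2, if_pos u.2, h.total]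
  dom s := by
    have hut' : (u : ℕ) ≤ t := hut
    rw [psumC_wtC_add_dvec hx, psumC_wtC_add_dvec hc]
    by_cases ht : (t : ℕ) < s
    · rw [if_pos ht, if_pos (by omega)]
      exact (h.dom s).sub_sub _
    · rw [if_neg ht, sub_zero]
      split_ifs
      · exact (h.dom s).sub_right i
      · rw [sub_zero]
        exact h.dom s
  entry s := by
    have hut' : (u : ℕ) ≤ t := hut
    have := h.entry s
    rw [entrySum_add_dvec, entrySum_add_dvec]
    split_ifs <;> omega

/-- `v` equals `v_x` plus a combination of basis vectors `v_c` with `c` a left shift of `x`. -/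
structure LeadsWith {n : ℕ} (m : ℕ) (x : Fin n → ℤ) (v : VT n) : Prop where
  coeff : v x = 1
  supp : ∀ c ∈ v.support, LeftShift m x c

lemma LeadsWith.FF_step {n m i : ℕ} {x : Fin n → ℤ} {v : VT n} (h : LeadsWith m x v) {t : Fin n}
    (htm : (t : ℕ) + 1 = m) (hx : x t = (i : ℤ) ∨ x t = -(i : ℤ))
    (hi : ∀ s : Fin n, t < s → ¬(x s = (i : ℤ) ∨ x s = -(i : ℤ))) :
    LeadsWith m (x + dvec n t) (FF n i v) := by
  have key : ∀ c ∈ v.support, ∀ u : Fin n, (c u = (i : ℤ) ∨ c u = -(i : ℤ)) → u ≤ t := by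
    intro c hc u hu
    by_contra hlt
    rw [not_le] at hlt
    have h1 : (t : ℕ) < u := hlt
    rw [(h.supp c hc).eq_of_le u (by omega)] at hu
    exact hi u hlt hu
  have uniq : ∀ c ∈ v.support, ∀ u : Fin n, (c u = (i : ℤ) ∨ c u = -(i : ℤ)) →
      c + dvec n u = x + dvec n t → u = t := by
    intro c hc u hu he
    by_contra hne
    have h1 : (u : ℕ) < t := lt_of_le_of_ne (key c hc u hu) (Fin.val_ne_of_ne hne)
    have h2 := congrArg (fun y => entrySum y (u + 1)) he
    have h3 := (h.supp c hc).entry (u + 1)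
    simp only [entrySum_add_dvec] at h2
    rw [if_pos (by omega), if_neg (by omega)] at h2
    omega
  refine ⟨?_, ?_⟩
  · have hxs : x ∈ v.support := by simp [h.coeff]
    rw [FF_apply_apply, Finset.sum_eq_single x, h.coeff, one_mul, Finset.sum_eq_single t]
    · simp
    · intro u hu hne
      rw [if_neg fun he => hne (uniq x hxs u (Finset.mem_filter.1 hu).2 he)]
    · intro ht
      simp [hx] at ht
    · intro c hc hne
      rw [Finset.sum_eq_zero, mul_zero]
      intro u hu
      refine if_neg fun he => hne ?_
      rw [uniq c hc u (Finset.mem_filter.1 hu).2 he] at he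
      exact add_right_cancel he
    · exact fun hx' => absurd hxs hx'
  · intro y hy
    obtain ⟨c, hc, u, hu, rfl⟩ := exists_of_mem_support_FF hy
    exact (h.supp c hc).add_dvec (key c hc u hu) (by omega) hx hu

lemma LeadsWith.exists_raise {n m : ℕ} {x : Fin n → ℤ} {v : VT n} (h : LeadsWith m x v)
    {t : Fin n} (htm : (t : ℕ) + 1 = m) (k : ℕ)
    (hk : ∀ s : Fin n, t < s → ∀ j < k, |x t + (j : ℤ)| < |x s|) :
    ∃ L : List ℕ, LeadsWith m (x + (k : ℤ) • dvec n t) (L.foldl (fun v i => FF n i v) v) := by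
  induction k with
  | zero => exact ⟨[], by simpa using h⟩
  | succ k ih =>
    obtain ⟨L, hL⟩ := ih fun s hs j hj => hk s hs j (by omega)
    refine ⟨L ++ [(x t + (k : ℤ)).natAbs], ?_⟩
    rw [List.foldl_append]
    have := hL.FF_step (i := (x t + (k : ℤ)).natAbs) htm
      (by simp only [Pi.add_apply, Pi.smul_apply, dvec, if_true, smul_eq_mul, mul_one]; omega)
      (by
        intro s hs
        have h1 := hk s hs k (by omega)
        have h2 : s ≠ t := hs.ne'
        simp only [Pi.add_apply, Pi.smul_apply, dvec, if_neg h2, smul_eq_mul, mul_zero, add_zero]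
        rw [Int.abs_eq_natAbs, Int.abs_eq_natAbs] at h1
        omega)
    push_cast
    rw [add_smul, one_smul, ← add_assoc]
    exact this

theorem statement_7 (n : ℕ) (hn : 1 ≤ n) (b : Fin n → ℤ) :
    ∃ (a : Fin n → ℤ) (L : List ℕ),
      (∀ r s : Fin n, r < s → a s < a r) ∧
      (∀ r s : Fin n, r < s → a r + a s ≠ 1) ∧
      ∃ w : VT n,
        L.foldl (fun v i => FF n i v) (Finsupp.single a 1) = Finsupp.single b 1 + w ∧
        ∀ c ∈ w.support, BruhatC b c ∧ c ≠ b := by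
  obtain ⟨M, hM⟩ : ∃ M : ℕ, ∀ t, (b t).natAbs ≤ M :=
    ⟨Finset.univ.sup fun t => (b t).natAbs,
      fun t => Finset.le_sup (f := fun t => (b t).natAbs) (Finset.mem_univ t)⟩
  let a : Fin n → ℤ := fun t => -((M : ℤ) + (t : ℕ) + 1)
  have main : ∀ m ≤ n, ∃ L : List ℕ, LeadsWith m
      (fun s : Fin n => if (s : ℕ) < m then b s else a s)
      (L.foldl (fun v i => FF n i v) (Finsupp.single a 1)) := by
    intro m
    induction m with
    | zero =>
      refine fun _ => ⟨[], ?_⟩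
      simp only [Nat.not_lt_zero, if_false, List.foldl_nil]
      refine ⟨by simp, fun c hc => ?_⟩
      rw [Finset.mem_singleton.1 (Finsupp.support_single_subset hc)]
      exact LeftShift.refl _ _
    | succ m ih =>
      intro hm
      obtain ⟨L, hL⟩ := ih (by omega)
      have hL' := (⟨hL.coeff, fun c hc => (hL.supp c hc).mono (Nat.le_succ m)⟩ :
        LeadsWith (m + 1) _ _)
      let t : Fin n := ⟨m, hm⟩
      have hbt := hM t
      obtain ⟨L', h'⟩ := hL'.exists_raise (t := t) rfl (b t - a t).toNat (by
        intro s hs j hj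
        have hs' : m < s := hs
        simp only [t, lt_irrefl, if_false, if_neg (show ¬ (s : ℕ) < m by omega)]
        simp only [a, t] at hj hbt ⊢
        rw [Int.abs_eq_natAbs, Int.abs_eq_natAbs]
        omega)
      refine ⟨L ++ L', ?_⟩
      rw [List.foldl_append]
      convert h' using 1
      ext s
      simp only [Pi.add_apply, Pi.smul_apply, dvec, smul_eq_mul]
      by_cases hst : s = t
      · subst hst
        simp only [t, a, lt_irrefl, Nat.lt_succ_self, if_true, if_false]
        simp only [t] at hbt
        omega
      · have : (s : ℕ) ≠ m := fun h => hst (Fin.ext h)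
        rw [if_neg hst, mul_zero, add_zero]
        split_ifs <;> first | rfl | omega
  obtain ⟨L, hL⟩ := main n le_rfl
  simp only [Fin.is_lt, if_true] at hL
  refine ⟨a, L, ?_, ?_, L.foldl (fun v i => FF n i v) (Finsupp.single a 1) - Finsupp.single b 1,
    by abel, ?_⟩
  · intro r s hrs
    have : (r : ℕ) < s := hrs
    simp only [a]
    omega
  · intro r s _
    simp only [a]
    omega
  · intro c hc
    have hcb : c ≠ b := by
      rintro rfl
      simp [hL.coeff] at hc
    have hc' : c ∈ (L.foldl (fun v i => FF n i v) (Finsupp.single a (1 : ℚ))).support := by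
      rw [Finsupp.mem_support_iff] at hc ⊢
      simpa [Finsupp.single_apply, hcb.symm] using hc
    have hs := hL.supp c hc'
    exact ⟨⟨hs.total, fun s _ _ => hs.dom s⟩, hcb⟩
end

section
/- Let n ≥ 1, B = ℤ^n, and fix σ ∈ {+1,−1}^n. Define B_{≤σ} := {b ∈ B : N_{[1,s]}(b,0) ≤ σ_1 + ⋯ + σ_s for s = 1,…,n−1, and N_{[1,n]}(b,0) = σ_1 + ⋯ + σ_n}, and B_{<σ} := {b ∈ B_{≤σ} : N_{[1,s]}(b,0) < σ_1 + ⋯ + σ_s for at least one s ∈ {1,…,n−1}}. Then: (i) B_{≤σ} and B_{<σ} are both lower sets (ideals) in B with respect to the sp_{2∞}-Bruhat order ⪯; and (ii) B_{≤σ} \ B_{<σ} = B_σ := {b ∈ B : b_r > 0 whenever σ_r = +1, and b_r ≤ 0 whenever σ_r = −1}. -/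
/-!
STATEMENT 12: truncation sets attached to a sign sequence σ: B_{≤σ} and B_{<σ} are
lower sets (ideals) for the sp_{2∞}-Bruhat order, and their difference is B_σ.
-/

open Finsupp

/-- `N_{[1,s]}(b,i) = #{r ≤ s : b_r > i} − #{r ≤ s : b_r ≤ −i}`. -/
def NC {n : ℕ} (b : Fin n → ℤ) (i : ℤ) (s : ℕ) : ℤ :=
  ((Finset.univ.filter fun r : Fin n => (r : ℕ) < s ∧ i < b r).card : ℤ) -
  ((Finset.univ.filter fun r : Fin n => (r : ℕ) < s ∧ b r ≤ -i).card : ℤ)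

/-- B_{≤σ}. -/
def BleS {n : ℕ} (σ : Fin n → ℤ) : Set (Fin n → ℤ) :=
  {b | (∀ s : ℕ, 1 ≤ s → s < n →
          NC b 0 s ≤ ∑ r ∈ Finset.univ.filter (fun r : Fin n => (r : ℕ) < s), σ r) ∧
       NC b 0 n = ∑ r : Fin n, σ r}

/-- B_{<σ}. -/
def BltS {n : ℕ} (σ : Fin n → ℤ) : Set (Fin n → ℤ) :=
  {b | b ∈ BleS σ ∧ ∃ s : ℕ, 1 ≤ s ∧ s < n ∧
        NC b 0 s < ∑ r ∈ Finset.univ.filter (fun r : Fin n => (r : ℕ) < s), σ r}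

/-- B_σ. -/
def Bsig {n : ℕ} (σ : Fin n → ℤ) : Set (Fin n → ℤ) :=
  {b | ∀ r, (σ r = 1 → 0 < b r) ∧ (σ r = -1 → b r ≤ 0)}

/-- The sign of an entry: `1` if positive and `-1` otherwise. -/
def posSign (x : ℤ) : ℤ := if 0 < x then 1 else -1

lemma NC_zero_eq_sum_posSign {n : ℕ} (b : Fin n → ℤ) (s : ℕ) :
    NC b 0 s = ∑ r ∈ Finset.univ.filter (fun r : Fin n => (r : ℕ) < s), posSign (b r) := by
  unfold NC
  rw [Finset.card_filter, Finset.card_filter, Finset.sum_filter]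
  push_cast
  rw [← Finset.sum_sub_distrib]
  refine Finset.sum_congr rfl fun r _ => ?_
  unfold posSign
  by_cases h : (r : ℕ) < s <;> by_cases h' : 0 < b r <;> simp [h, h', not_le]

lemma degree_wtC {n : ℕ} (b : Fin n → ℤ) (r : Fin n) :
    Finsupp.linearCombination ℤ (fun _ : ℕ => (1 : ℤ)) (wtC b r) = posSign (b r) := by
  unfold wtC posSign epsC
  split_ifs <;> simp

lemma degree_psumC_wtC {n : ℕ} (b : Fin n → ℤ) (s : ℕ) :
    Finsupp.linearCombination ℤ (fun _ : ℕ => (1 : ℤ)) (psumC (wtC b) s) = NC b 0 s := by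
  rw [NC_zero_eq_sum_posSign, psumC, map_sum]
  exact Finset.sum_congr rfl fun r _ => degree_wtC b r

lemma degree_alphaC_nonpos (i : ℕ) :
    Finsupp.linearCombination ℤ (fun _ : ℕ => (1 : ℤ)) (alphaC i) ≤ 0 := by
  unfold alphaC epsC
  split_ifs <;> simp

lemma DomC.degree_le {lam mu : PC} (h : DomC lam mu) :
    Finsupp.linearCombination ℤ (fun _ : ℕ => (1 : ℤ)) lam ≤
      Finsupp.linearCombination ℤ (fun _ : ℕ => (1 : ℤ)) mu := by
  obtain ⟨c, hc⟩ := h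
  rw [← sub_nonpos, ← map_sub, hc, Finsupp.sum, map_sum]
  refine Finset.sum_nonpos fun i _ => ?_
  rw [map_smul, smul_eq_mul]
  exact mul_nonpos_of_nonneg_of_nonpos (Int.natCast_nonneg _) (degree_alphaC_nonpos i)

lemma BruhatC.NC_le {n : ℕ} {a b : Fin n → ℤ} (h : BruhatC a b) {s : ℕ} (hs : 1 ≤ s)
    (hsn : s ≤ n) : NC a 0 s ≤ NC b 0 s := by
  simpa only [degree_psumC_wtC] using (h.2 s hs hsn).degree_le

lemma BruhatC.NC_eq {n : ℕ} {a b : Fin n → ℤ} (h : BruhatC a b) : NC a 0 n = NC b 0 n := by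
  rw [← degree_psumC_wtC, ← degree_psumC_wtC]
  exact congrArg _ h.1

lemma BruhatC.mem_BleS {n : ℕ} {σ a b : Fin n → ℤ} (h : BruhatC a b) (hb : b ∈ BleS σ) :
    a ∈ BleS σ :=
  ⟨fun s hs hsn => (h.NC_le hs hsn.le).trans (hb.1 s hs hsn), h.NC_eq.trans hb.2⟩

lemma BruhatC.mem_BltS {n : ℕ} {σ a b : Fin n → ℤ} (h : BruhatC a b) (hb : b ∈ BltS σ) :
    a ∈ BltS σ := by
  obtain ⟨hle, s, hs, hsn, hlt⟩ := hb
  exact ⟨h.mem_BleS hle, s, hs, hsn, (h.NC_le hs hsn.le).trans_lt hlt⟩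

lemma sum_filter_val_lt_succ {n : ℕ} (f : Fin n → ℤ) (r : Fin n) :
    ∑ t ∈ Finset.univ.filter (fun t : Fin n => (t : ℕ) < r + 1), f t =
      f r + ∑ t ∈ Finset.univ.filter (fun t : Fin n => (t : ℕ) < r), f t := by
  rw [← Finset.sum_insert (by simp)]
  refine Finset.sum_congr ?_ fun _ _ => rfl
  ext t
  simp [Fin.ext_iff]
  omega

lemma mem_Bsig_iff {n : ℕ} {σ : Fin n → ℤ} (hσ : ∀ r, σ r = 1 ∨ σ r = -1) (b : Fin n → ℤ) :
    b ∈ Bsig σ ↔ ∀ r, posSign (b r) = σ r := by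
  refine forall_congr' fun r => ?_
  unfold posSign
  rcases hσ r with h | h <;> simp [h]

lemma mem_BleS_diff_BltS_iff {n : ℕ} {σ : Fin n → ℤ} (b : Fin n → ℤ) :
    b ∈ BleS σ \ BltS σ ↔ ∀ r, posSign (b r) = σ r := by
  constructor
  · rintro ⟨hle, hlt⟩
    have key : ∀ s ≤ n, ∑ r ∈ Finset.univ.filter (fun r : Fin n => (r : ℕ) < s), posSign (b r) =
        ∑ r ∈ Finset.univ.filter (fun r : Fin n => (r : ℕ) < s), σ r := by
      intro s hsn
      rcases Nat.eq_zero_or_pos s with rfl | hs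
      · simp
      rw [← NC_zero_eq_sum_posSign]
      rcases hsn.eq_or_lt with rfl | hsn
      · simpa using hle.2
      · exact (hle.1 s hs hsn).antisymm (not_lt.1 fun h => hlt ⟨hle, s, hs, hsn, h⟩)
    intro r
    have h := key (r + 1) r.isLt
    rw [sum_filter_val_lt_succ, sum_filter_val_lt_succ, key r r.isLt.le] at h
    exact add_right_cancel h
  · intro h
    have key : ∀ s, NC b 0 s =
        ∑ r ∈ Finset.univ.filter (fun r : Fin n => (r : ℕ) < s), σ r := fun s => by
      rw [NC_zero_eq_sum_posSign]
      exact Finset.sum_congr rfl fun r _ => h r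
    refine ⟨⟨fun s _ _ => (key s).le, by simpa using key n⟩, ?_⟩
    rintro ⟨-, s, -, -, hs⟩
    exact hs.ne (key s)

theorem statement_12 (n : ℕ) (hn : 1 ≤ n) (σ : Fin n → ℤ)
    (hσ : ∀ r, σ r = 1 ∨ σ r = -1) :
    (∀ a b : Fin n → ℤ, b ∈ BleS σ → BruhatC a b → a ∈ BleS σ) ∧
    (∀ a b : Fin n → ℤ, b ∈ BltS σ → BruhatC a b → a ∈ BltS σ) ∧
    (BleS σ \ BltS σ = Bsig σ) := by
  refine ⟨fun a b hb h => h.mem_BleS hb, fun a b hb h => h.mem_BltS hb, ?_⟩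
  ext b
  rw [mem_BleS_diff_BltS_iff, mem_Bsig_iff hσ]
end

section
/- Let n = n_0 + n_1 with n_0, n_1 ≥ 0, and let B^+_{n_0|n_1} := {b ∈ ℤ^n : b_1 > ⋯ > b_{n_0} > 0 ≥ b_{n_0+1} > ⋯ > b_n}. Call b ∈ ℤ^n typical if b_r + b_s ≠ 1 for all 1 ≤ r < s ≤ n. Then every b ∈ B^+_{n_0|n_1} can be connected to a typical element a ∈ B^+_{n_0|n_1} by applying a finite sequence of the crystal operators ẽ_i, f̃_i with i ≥ 1: that is, there exist l ≥ 0 and b = b^{(0)}, b^{(1)}, …, b^{(l)} = a in ℤ^n such that a ∈ B^+_{n_0|n_1} is typical and for each k there is some integer i ≥ 1 with b^{(k+1)} = f̃_i b^{(k)} or b^{(k+1)} = ẽ_i b^{(k)} (in particular the relevant operator value is not ∅). -/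
/-- The i-signature of `b`, recorded as the list of positions carrying a non-• letter
together with the letter (`true` = f, `false` = e), in increasing order of position:
position `t` carries f if `b t = ±i` and e if `b t = 1 ± i`. -/
def sigList (n : ℕ) (i : ℕ) (b : Fin n → ℤ) : List (Fin n × Bool) :=
  (List.finRange n).filterMap fun t =>
    if b t = (i : ℤ) ∨ b t = -(i : ℤ) then some (t, true)
    else if b t = 1 + (i : ℤ) ∨ b t = 1 - (i : ℤ) then some (t, false)
    else none

/-- Reduction of a signature: repeatedly cancel a pair consisting of an e (`false`)
followed (after only •'s, i.e. adjacently in the list of non-• letters) by an f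
(`true`), until no e occurs before any f.  Processing from the right, an e cancels
with the nearest surviving f to its right. -/
def cancel {α : Type} : List (α × Bool) → List (α × Bool)
  | [] => []
  | x :: rest =>
    match cancel rest with
    | (q, true) :: rest' => if x.2 = false then rest' else x :: (q, true) :: rest'
    | l => x :: l

/-- The crystal operator `f̃_i`: add `d_r` where `r` is the position of the rightmost
f in the reduced i-signature, or `∅` (i.e. `none`) if no f remains. -/
def ftilde {n : ℕ} (i : ℕ) (b : Fin n → ℤ) : Option (Fin n → ℤ) :=
  match ((cancel (sigList n i b)).filter fun x => x.2).getLast? with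
  | some x => some (b + dvec n x.1)
  | none => none

/-- The crystal operator `ẽ_i`: subtract `d_s` where `s` is the position of the
leftmost e in the reduced i-signature, or `∅` if no e remains. -/
def etilde {n : ℕ} (i : ℕ) (b : Fin n → ℤ) : Option (Fin n → ℤ) :=
  match ((cancel (sigList n i b)).filter fun x => !x.2).head? with
  | some x => some (b - dvec n x.1)
  | none => none

/-- B⁺_{n₀|n₁} = {b ∈ ℤ^n : b₁ > ⋯ > b_{n₀} > 0 ≥ b_{n₀+1} > ⋯ > b_n}, i.e. strictly
decreasing tuples whose first n₀ entries are positive and remaining entries are ≤ 0. -/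
def BplusSet (n n0 : ℕ) : Set (Fin n → ℤ) :=
  {b | (∀ r s : Fin n, r < s → b s < b r) ∧ ∀ r : Fin n, (0 < b r ↔ (r : ℕ) < n0)}

/-- `b` is typical if `b r + b s ≠ 1` for all `r < s`. -/
def Typical {n : ℕ} (b : Fin n → ℤ) : Prop := ∀ r s : Fin n, r < s → b r + b s ≠ 1

theorem mem_sigList {n i : ℕ} {b : Fin n → ℤ} (hi : 1 ≤ i) (x : Fin n × Bool) :
    x ∈ sigList n i b ↔
      (x.2 = true ∧ (b x.1 = i ∨ b x.1 = -i)) ∨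
        (x.2 = false ∧ (b x.1 = 1 + i ∨ b x.1 = 1 - i)) := by
  obtain ⟨t, c⟩ := x
  simp only [sigList, List.mem_filterMap, List.mem_finRange, true_and]
  constructor
  · rintro ⟨u, hu⟩
    split_ifs at hu with h1 h2
    · simp only [Option.some.injEq, Prod.mk.injEq] at hu
      obtain ⟨rfl, rfl⟩ := hu
      exact Or.inl ⟨rfl, h1⟩
    · simp only [Option.some.injEq, Prod.mk.injEq] at hu
      obtain ⟨rfl, rfl⟩ := hu
      exact Or.inr ⟨rfl, h2⟩
  · rintro (⟨rfl, h⟩ | ⟨rfl, h⟩)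
    · exact ⟨t, by rw [if_pos h]⟩
    · refine ⟨t, ?_⟩
      rw [if_neg (by omega), if_pos h]

theorem pairwise_sigList {n : ℕ} (i : ℕ) (b : Fin n → ℤ) :
    (sigList n i b).Pairwise fun x y => x.1 < y.1 := by
  refine (List.pairwise_lt_finRange n).filterMap _ fun u v huv x hx y hy => ?_
  have fst_eq : ∀ (u : Fin n) (x : Fin n × Bool),
      (if b u = (i : ℤ) ∨ b u = -(i : ℤ) then some (u, true)
        else if b u = 1 + (i : ℤ) ∨ b u = 1 - (i : ℤ) then some (u, false)
        else none) = some x → x.1 = u := by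
    intro u x hx
    split_ifs at hx <;> cases hx <;> rfl
  rwa [fst_eq u x hx, fst_eq v y hy]

/-- A signature is determined by its set of letters, as its positions increase. -/
theorem sigList_eq {n i : ℕ} {b : Fin n → ℤ} {l : List (Fin n × Bool)}
    (hl : l.Pairwise fun x y => x.1 < y.1) (h : ∀ x, x ∈ sigList n i b ↔ x ∈ l) :
    sigList n i b = l := by
  have nodup : ∀ l : List (Fin n × Bool), (l.Pairwise fun x y => x.1 < y.1) → l.Nodup :=
    fun l hl => hl.imp fun hxy hEq => (hEq ▸ hxy).false
  have hp : (sigList n i b).Perm l :=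
    (List.perm_ext_iff_of_nodup (nodup _ (pairwise_sigList i b)) (nodup _ hl)).2 h
  exact hp.eq_of_pairwise (fun _ _ _ _ hxy hyx => (lt_asymm hxy hyx).elim)
    (pairwise_sigList i b) hl

theorem injective_of_mem_BplusSet {n n0 : ℕ} {b : Fin n → ℤ} (hb : b ∈ BplusSet n n0) :
    Function.Injective b :=
  StrictAnti.injective fun r s h => hb.1 r s h

theorem lt_of_apply_lt_of_mem_BplusSet {n n0 : ℕ} {b : Fin n → ℤ} (hb : b ∈ BplusSet n n0)
    {r s : Fin n} (h : b s < b r) : r < s :=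
  (StrictAnti.lt_iff_gt (f := b) fun r s h => hb.1 r s h).1 h

theorem add_dvec_mem_BplusSet {n n0 : ℕ} {b : Fin n → ℤ} (hb : b ∈ BplusSet n n0)
    {r : Fin n} (hr : 0 < b r) (hfree : ∀ t, b t ≠ b r + 1) :
    b + dvec n r ∈ BplusSet n n0 := by
  refine ⟨fun u v huv => ?_, fun u => ?_⟩
  · have h1 := hb.1 u v huv
    have h2 := hfree u
    simp only [Pi.add_apply, dvec]
    split_ifs with hv hu hu <;> subst_vars <;> omega
  · rw [← hb.2 u]
    simp only [Pi.add_apply, dvec]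
    split_ifs with hu <;> subst_vars <;> omega

theorem sub_dvec_mem_BplusSet {n n0 : ℕ} {b : Fin n → ℤ} (hb : b ∈ BplusSet n n0)
    {s : Fin n} (hs : b s ≤ 0) (hfree : ∀ t, b t ≠ b s - 1) :
    b - dvec n s ∈ BplusSet n n0 := by
  refine ⟨fun u v huv => ?_, fun u => ?_⟩
  · have h1 := hb.1 u v huv
    have h2 := hfree v
    simp only [Pi.sub_apply, dvec]
    split_ifs with hv hu hu <;> subst_vars <;> omega
  · rw [← hb.2 u]
    simp only [Pi.sub_apply, dvec]
    split_ifs with hu <;> subst_vars <;> omega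

section Signature

variable {n n0 i : ℕ} {b : Fin n → ℤ} {p q r s : Fin n}

theorem ftilde_of_fe (hb : b ∈ BplusSet n n0) (hi : 1 ≤ i) (hr : b r = i) (hs : b s = 1 - i)
    (hp : ∀ t, b t ≠ i + 1) (hq : ∀ t, b t ≠ -i) : ftilde i b = some (b + dvec n r) := by
  have hsig : sigList n i b = [(r, true), (s, false)] := by
    refine sigList_eq ?_ fun ⟨t, c⟩ => ?_
    · have : r < s := lt_of_apply_lt_of_mem_BplusSet hb (by omega)
      simpa
    · have h1 := hp t
      have h2 := hq t
      have h3 : t = r ↔ b t = i := hr ▸ (injective_of_mem_BplusSet hb).eq_iff.symm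
      have h4 : t = s ↔ b t = 1 - i := hs ▸ (injective_of_mem_BplusSet hb).eq_iff.symm
      rw [mem_sigList hi]
      simp only [List.mem_cons, Prod.mk.injEq, List.not_mem_nil, or_false, h3, h4]
      grind
  simp [ftilde, hsig, cancel]

theorem etilde_of_efe (hb : b ∈ BplusSet n n0) (hi : 1 ≤ i) (hp : b p = i + 1) (hr : b r = i)
    (hs : b s = 1 - i) (hq : ∀ t, b t ≠ -i) : etilde i b = some (b - dvec n s) := by
  have hsig : sigList n i b = [(p, false), (r, true), (s, false)] := by
    refine sigList_eq ?_ fun ⟨t, c⟩ => ?_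
    · have h1 : p < r := lt_of_apply_lt_of_mem_BplusSet hb (by omega)
      have h2 : r < s := lt_of_apply_lt_of_mem_BplusSet hb (by omega)
      simp [h1, h2, h1.trans h2]
    · have h1 := hq t
      have h2 : t = p ↔ b t = i + 1 := hp ▸ (injective_of_mem_BplusSet hb).eq_iff.symm
      have h3 : t = r ↔ b t = i := hr ▸ (injective_of_mem_BplusSet hb).eq_iff.symm
      have h4 : t = s ↔ b t = 1 - i := hs ▸ (injective_of_mem_BplusSet hb).eq_iff.symm
      rw [mem_sigList hi]
      simp only [List.mem_cons, Prod.mk.injEq, List.not_mem_nil, or_false, h2, h3, h4]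
      grind
  simp [etilde, hsig, cancel]

theorem ftilde_of_fef (hb : b ∈ BplusSet n n0) (hi : 1 ≤ i) (hr : b r = i) (hs : b s = 1 - i)
    (hq : b q = -i) (hp : ∀ t, b t ≠ i + 1) : ftilde i b = some (b + dvec n r) := by
  have hsig : sigList n i b = [(r, true), (s, false), (q, true)] := by
    refine sigList_eq ?_ fun ⟨t, c⟩ => ?_
    · have h1 : r < s := lt_of_apply_lt_of_mem_BplusSet hb (by omega)
      have h2 : s < q := lt_of_apply_lt_of_mem_BplusSet hb (by omega)
      simp [h1, h2, h1.trans h2]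
    · have h1 := hp t
      have h2 : t = q ↔ b t = -i := hq ▸ (injective_of_mem_BplusSet hb).eq_iff.symm
      have h3 : t = r ↔ b t = i := hr ▸ (injective_of_mem_BplusSet hb).eq_iff.symm
      have h4 : t = s ↔ b t = 1 - i := hs ▸ (injective_of_mem_BplusSet hb).eq_iff.symm
      rw [mem_sigList hi]
      simp only [List.mem_cons, Prod.mk.injEq, List.not_mem_nil, or_false, h2, h3, h4]
      grind
  simp [ftilde, hsig, cancel]

end Signature

/-- One step of a crystal operator of positive index. -/
abbrev CrystalStep {n : ℕ} (x y : Fin n → ℤ) : Prop :=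
  ∃ i : ℕ, 1 ≤ i ∧ (ftilde i x = some y ∨ etilde i x = some y)

/-- If `m` is the only atypicality of `b` of value at least `k`, then it can be moved upwards
until it disappears, without creating further atypicalities of value at least `k`. -/
theorem exists_reflTransGen_atypicality_lt {n n0 : ℕ} (k N : ℤ) (d : ℕ) :
    ∀ (b : Fin n → ℤ) (m : ℕ), b ∈ BplusSet n n0 → 1 ≤ m → k ≤ m → N < m + d →
      (∀ t, b t ≤ N) → (∀ t, 1 - b t ≤ N) →
      (∀ r s, b r + b s = 1 → 1 ≤ b r → b r < k ∨ b r = m) →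
      ∃ a ∈ BplusSet n n0, (∀ r s, a r + a s = 1 → 1 ≤ a r → a r < k) ∧
        Relation.ReflTransGen CrystalStep b a := by
  induction d with
  | zero =>
    intro b m hb _ _ hN hbN _ hatyp
    refine ⟨b, hb, fun r s hrs h1 => (hatyp r s hrs h1).resolve_right fun h => ?_, .refl⟩
    have := hbN r
    omega
  | succ d ih =>
    intro b m hb hm hkm hN hbN hbN' hatyp
    by_cases hpair : ∃ r s, b r = m ∧ b s = 1 - m
    swap
    · refine ⟨b, hb, fun r s hrs h1 => (hatyp r s hrs h1).resolve_right fun h => ?_, .refl⟩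
      exact hpair ⟨r, s, h, by omega⟩
    obtain ⟨r, s, hr, hs⟩ := hpair
    by_cases hp : ∃ p, b p = m + 1
    · obtain ⟨p, hp⟩ := hp
      have hq : ∀ t, b t ≠ -m := fun t ht => by
        have := hatyp p t (by omega) (by omega)
        omega
      obtain ⟨a, ha, hak, hba⟩ := ih (b - dvec n s) (m + 1)
        (sub_dvec_mem_BplusSet hb (by omega) fun t => by have := hq t; omega) (by omega) (by omega)
        (by push_cast at hN ⊢; omega)
        (fun t => by
          have := hbN t
          simp only [Pi.sub_apply, dvec]
          split_ifs <;> omega)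
        (fun t => by
          have := hbN' t
          have := hbN p
          simp only [Pi.sub_apply, dvec]
          split_ifs with h
          · subst h; omega
          · omega)
        (fun u v => by
          have h1 := hatyp u v
          have h2 : u = s ↔ b u = 1 - m := hs ▸ (injective_of_mem_BplusSet hb).eq_iff.symm
          have h3 : v = s ↔ b v = 1 - m := hs ▸ (injective_of_mem_BplusSet hb).eq_iff.symm
          simp only [Pi.sub_apply, dvec, h2, h3]
          push_cast
          split_ifs <;> omega)
      exact ⟨a, ha, hak, .head ⟨m, hm, .inr (etilde_of_efe hb hm hp hr hs hq)⟩ hba⟩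
    · push Not at hp
      have hmem : b + dvec n r ∈ BplusSet n n0 :=
        add_dvec_mem_BplusSet hb (by omega) fun t => by have := hp t; omega
      by_cases hq : ∃ q, b q = -m
      · obtain ⟨q, hq⟩ := hq
        obtain ⟨a, ha, hak, hba⟩ := ih (b + dvec n r) (m + 1) hmem (by omega) (by omega)
          (by push_cast at hN ⊢; omega)
          (fun t => by
            have := hbN t
            have := hbN' q
            simp only [Pi.add_apply, dvec]
            split_ifs with h
            · subst h; omega
            · omega)
          (fun t => by
            have := hbN' t
            simp only [Pi.add_apply, dvec]
            split_ifs <;> omega)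
          (fun u v => by
            have h1 := hatyp u v
            have h2 : u = r ↔ b u = m := hr ▸ (injective_of_mem_BplusSet hb).eq_iff.symm
            have h3 : v = r ↔ b v = m := hr ▸ (injective_of_mem_BplusSet hb).eq_iff.symm
            simp only [Pi.add_apply, dvec, h2, h3]
            push_cast
            split_ifs <;> omega)
        exact ⟨a, ha, hak, .head ⟨m, hm, .inl (ftilde_of_fef hb hm hr hs hq hp)⟩ hba⟩
      · push Not at hq
        refine ⟨b + dvec n r, hmem, fun u v => ?_,
          .single ⟨m, hm, .inl (ftilde_of_fe hb hm hr hs hp hq)⟩⟩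
        have h1 := hatyp u v
        have h2 : u = r ↔ b u = m := hr ▸ (injective_of_mem_BplusSet hb).eq_iff.symm
        have h3 : v = r ↔ b v = m := hr ▸ (injective_of_mem_BplusSet hb).eq_iff.symm
        have h4 := hq v
        simp only [Pi.add_apply, dvec, h2, h3]
        split_ifs <;> omega

theorem exists_reflTransGen_no_atypicality {n n0 : ℕ} (k : ℕ) :
    ∀ b : Fin n → ℤ, b ∈ BplusSet n n0 → (∀ r s, b r + b s = 1 → 1 ≤ b r → b r < k + 1) →
      ∃ a ∈ BplusSet n n0, (∀ r s, a r + a s = 1 → ¬ 1 ≤ a r) ∧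
        Relation.ReflTransGen CrystalStep b a := by
  induction k with
  | zero =>
    intro b hb hatyp
    refine ⟨b, hb, fun r s hrs h1 => ?_, .refl⟩
    have := hatyp r s hrs h1
    omega
  | succ k ih =>
    intro b hb hatyp
    obtain ⟨N, hN⟩ : ∃ N : ℤ, ∀ t, |b t| + 1 ≤ N :=
      ⟨∑ t, |b t| + 1, fun t => by
        have := Finset.single_le_sum (f := fun t => |b t|) (fun _ _ => abs_nonneg _)
          (Finset.mem_univ t)
        simpa using this⟩
    obtain ⟨a, ha, hak, hba⟩ := exists_reflTransGen_atypicality_lt (n0 := n0) (k + 1 : ℤ) N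
      (N.toNat + 1) b (k + 1) hb (by omega) (by push_cast; omega) (by push_cast; omega)
      (fun t => by have := hN t; have := le_abs_self (b t); omega)
      (fun t => by have := hN t; have := neg_abs_le (b t); omega)
      (fun r s hrs h1 => by have := hatyp r s hrs h1; push_cast at this ⊢; omega)
    obtain ⟨c, hc, hck, hac⟩ := ih a ha hak
    exact ⟨c, hc, hck, hba.trans hac⟩

theorem statement_17 (n0 n1 n : ℕ) (hn : n = n0 + n1) (b : Fin n → ℤ)
    (hb : b ∈ BplusSet n n0) :
    ∃ a : Fin n → ℤ, a ∈ BplusSet n n0 ∧ Typical a ∧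
      Relation.ReflTransGen
        (fun x y : Fin n → ℤ =>
          ∃ i : ℕ, 1 ≤ i ∧ (ftilde i x = some y ∨ etilde i x = some y)) b a := by
  obtain ⟨a, ha, hatyp, hba⟩ := exists_reflTransGen_no_atypicality (∑ t, (b t).natAbs) b hb
    fun r s _ _ => by
      have := Finset.single_le_sum (f := fun t => (b t).natAbs) (fun _ _ => Nat.zero_le _)
        (Finset.mem_univ r)
      omega
  refine ⟨a, ha, fun r s hrs h => hatyp r s h ?_, hba⟩
  have := ha.1 r s hrs
  omega
end

section
/- Let n ≥ 1. Let P be the free abelian group on generators ε_i (i ∈ ℕ), with simple roots α_0 := −2ε_0 and α_i := ε_{i−1} − ε_i (i ≥ 1), dominance order λ ⊵ μ iff λ − μ is a finite ℕ-linear combination of the α_i, and inverse dominance order ⪯ on P^n given by: β ⪯ γ iff β_1 + ⋯ + β_n = γ_1 + ⋯ + γ_n and β_1 + ⋯ + β_s ⊵ γ_1 + ⋯ + γ_s for each s = 1,…,n. Then the inverse dominance order on P^n is interval-finite: for all β, γ ∈ P^n, the set {δ ∈ P^n : β ⪯ δ ⪯ γ} is finite. -/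
/-!
STATEMENT 18: the inverse dominance order on P^n (for the weight lattice P of
sp_{2∞}) is interval-finite.
-/

open Finsupp

/-- The combination `∑ c_i α_i` is additive in the coefficients. -/
theorem sum_alphaC_add (c d : ℕ →₀ ℕ) :
    ((c + d).sum fun i k => (k : ℤ) • alphaC i) =
      (c.sum fun i k => (k : ℤ) • alphaC i) + d.sum fun i k => (k : ℤ) • alphaC i :=
  Finsupp.sum_add_index' (by simp) (by intros; push_cast; exact add_smul _ _ _)

/-- The coefficient of `ε_j` in `∑ c_i α_i`. -/
theorem sum_alphaC_apply (c : ℕ →₀ ℕ) (j : ℕ) :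
    (c.sum fun i k => (k : ℤ) • alphaC i) j =
      (c (j + 1) : ℤ) - (if j = 0 then 2 else 1) * c j := by
  induction c using Finsupp.induction_linear with
  | zero => simp
  | add c d hc hd =>
    rw [sum_alphaC_add, Finsupp.add_apply, hc, hd]
    simp only [Finsupp.add_apply]
    push_cast
    ring
  | single i k =>
    rw [Finsupp.sum_single_index (by simp)]
    rcases i with _ | i
    · rcases j with _ | j <;> (simp [alphaC, epsC]; try ring)
    · rw [alphaC, if_neg i.succ_ne_zero, Nat.add_sub_cancel, epsC, epsC, Finsupp.smul_apply,
        Finsupp.sub_apply]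
      simp only [Finsupp.single_apply, smul_eq_mul]
      split_ifs <;> omega

/-- The simple roots are linearly independent. -/
theorem sum_alphaC_injective :
    Function.Injective fun c : ℕ →₀ ℕ => c.sum fun i k => (k : ℤ) • alphaC i := by
  intro c d h
  have key (j : ℕ) : c (j + 1) = d (j + 1) → c j = d j := by
    intro hj
    have := DFunLike.congr_fun h j
    simp only [sum_alphaC_apply] at this
    split_ifs at this <;> omega
  obtain ⟨N, hN⟩ := (c.support ∪ d.support).exists_nat_subset_range
  ext j
  by_cases hj : N ≤ j
  · have hmem : j ∉ c.support ∪ d.support := fun hm => by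
      have := Finset.mem_range.1 (hN hm)
      omega
    simp only [Finset.mem_union, Finsupp.mem_support_iff, not_or, not_not] at hmem
    rw [hmem.1, hmem.2]
  · have hNN : c N = d N := by
      have hmem : N ∉ c.support ∪ d.support := fun hm => by
        have := Finset.mem_range.1 (hN hm)
        omega
      simp only [Finset.mem_union, Finsupp.mem_support_iff, not_or, not_not] at hmem
      rw [hmem.1, hmem.2]
    exact Nat.decreasingInduction (motive := fun k _ => c k = d k)
      (fun k _ hk => key k hk) hNN (Nat.le_of_not_le hj)

/-- The dominance order is interval-finite. -/
theorem finite_setOf_domC (lam mu : PC) : {x : PC | DomC lam x ∧ DomC x mu}.Finite := by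
  rcases Set.eq_empty_or_nonempty {x : PC | DomC lam x ∧ DomC x mu} with h | ⟨y, ⟨a, ha⟩, b, hb⟩
  · rw [h]
    exact Set.finite_empty
  · refine ((Set.finite_Iic (a + b)).image
      fun c : ℕ →₀ ℕ => lam - c.sum fun i k => (k : ℤ) • alphaC i).subset ?_
    rintro x ⟨⟨c, hc⟩, d, hd⟩
    have hcd : c + d = a + b := sum_alphaC_injective <| by
      simp only [sum_alphaC_add, ← ha, ← hb, ← hc, ← hd]
      abel
    refine ⟨c, ?_, ?_⟩
    · rw [Set.mem_Iic, ← hcd]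
      exact le_self_add
    · simp only [← hc]
      abel

theorem psumC_succ {n : ℕ} (δ : Fin n → PC) (r : Fin n) :
    psumC δ (r + 1) = psumC δ r + δ r := by
  have : Finset.univ.filter (fun t : Fin n => (t : ℕ) < r + 1) =
      insert r (Finset.univ.filter fun t : Fin n => (t : ℕ) < r) := by
    ext t
    simp [Fin.ext_iff]
    omega
  rw [psumC, psumC, this, Finset.sum_insert (by simp), add_comm]

/-- A tuple is determined by its nonempty partial sums. -/
theorem psumC_injective (n : ℕ) :
    Function.Injective fun (δ : Fin n → PC) (r : Fin n) => psumC δ (r + 1) := by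
  intro δ δ' h
  have hs (s : ℕ) (hs : s ≤ n) : psumC δ s = psumC δ' s := by
    rcases s with _ | s
    · simp [psumC]
    · exact congr_fun h ⟨s, hs⟩
  ext1 r
  have h1 := hs (r + 1) r.2
  rw [psumC_succ, psumC_succ, hs r r.2.le] at h1
  exact add_left_cancel h1

theorem statement_18 (n : ℕ) (hn : 1 ≤ n) (β γ : Fin n → PC) :
    {δ : Fin n → PC | InvDomC β δ ∧ InvDomC δ γ}.Finite := by
  refine ((Set.Finite.pi' fun r : Fin n =>
    finite_setOf_domC (psumC β (r + 1)) (psumC γ (r + 1))).preimage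
      (psumC_injective n).injOn).subset ?_
  rintro δ ⟨h1, h2⟩ r
  exact ⟨h1.2 _ (Nat.le_add_left _ _) r.2, h2.2 _ (Nat.le_add_left _ _) r.2⟩
end
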